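/- arXiv:2004.00883 — 2 statements merged into one kernel-verified Lean document; each statement's English description precedes it below -/
import Mathlib

section
/- Let d ≥ 1, T ≥ 0 and c₁, …, c_d ≥ 0. Let J : ℝ → ℝ^d (Euclidean space) be differentiable on [0,T] with component functions J_i, and assume that J_i(t)·J_i'(t) ≥ −c_i·|J_i(t)| for every i ∈ {1,…,d} and every t ∈ [0,T]. Then ‖J(t)‖ ≥ ‖J(0)‖ − (∑_{i=1}^d c_i²)^{1/2}·t for all t ∈ [0,T]. -/
open MeasureTheory Set

theorem abs_sub_mul_le_abs_of_neg_mul_abs_le_mul_deriv {f f' : ℝ → ℝ} {c T : ℝ} (hc : 0 ≤ c)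
    (hf : ∀ t ∈ Set.Icc (0 : ℝ) T, HasDerivAt f (f' t) t)
    (hineq : ∀ t ∈ Set.Icc (0 : ℝ) T, -c * |f t| ≤ f t * f' t)
    {t : ℝ} (ht : t ∈ Set.Icc (0 : ℝ) T) : |f 0| - c * t ≤ |f t| := by
  refine le_of_forall_pos_le_add fun ε hε => ?_
  have hpos : ∀ s, 0 < f s ^ 2 + ε ^ 2 := fun s => by positivity
  have hg : ∀ s ∈ Set.Icc (0 : ℝ) T, HasDerivAt (fun s => √(f s ^ 2 + ε ^ 2) + c * s)
      (f s * f' s / √(f s ^ 2 + ε ^ 2) + c) s := by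
    intro s hs
    refine HasDerivAt.congr_deriv (((((hf s hs).pow 2).add_const (ε ^ 2)).sqrt (hpos s).ne').add
      ((hasDerivAt_id s).const_mul c)) ?_
    have hsqrt := (Real.sqrt_pos.2 (hpos s)).ne'
    simp only [Pi.pow_apply, Nat.cast_ofNat, Nat.add_one_sub_one, pow_one, mul_one]
    field_simp
  have hmono : MonotoneOn (fun s => √(f s ^ 2 + ε ^ 2) + c * s) (Set.Icc 0 T) := by
    refine monotoneOn_of_deriv_nonneg (convex_Icc 0 T)
      (fun s hs => (hg s hs).continuousAt.continuousWithinAt)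
      (fun s hs => (hg s (interior_subset hs)).differentiableAt.differentiableWithinAt)
      fun s hs => ?_
    have hs := interior_subset hs
    have hsqrt := Real.sqrt_pos.2 (hpos s)
    have habs : |f s| ≤ √(f s ^ 2 + ε ^ 2) := Real.abs_le_sqrt (by nlinarith)
    have hle : -c ≤ f s * f' s / √(f s ^ 2 + ε ^ 2) := by
      rw [le_div_iff₀ hsqrt]
      nlinarith [hineq s hs, mul_le_mul_of_nonneg_left habs hc]
    rw [(hg s hs).deriv]
    linarith
  have h := hmono ⟨le_rfl, ht.1.trans ht.2⟩ ht ht.1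
  have h0 : |f 0| ≤ √(f 0 ^ 2 + ε ^ 2) := Real.abs_le_sqrt (by nlinarith)
  have h1 : √(f t ^ 2 + ε ^ 2) ≤ |f t| + ε :=
    Real.sqrt_le_iff.2 ⟨by positivity, by nlinarith [sq_abs (f t), abs_nonneg (f t)]⟩
  simp only [mul_zero, add_zero] at h
  linarith

/-- Componentwise flux lower bound: if each component satisfies
`J i t * J' i t ≥ -c i * |J i t|` on `[0,T]`, then
`‖J t‖ ≥ ‖J 0‖ - sqrt (∑ i, (c i)^2) * t`. -/
theorem flux_lower_bound_componentwise
    (d : ℕ) (hd : 1 ≤ d) (T : ℝ) (hT : 0 ≤ T)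
    (c : Fin d → ℝ) (hc : ∀ i, 0 ≤ c i)
    (J J' : ℝ → EuclideanSpace ℝ (Fin d))
    (hderiv : ∀ t ∈ Set.Icc (0 : ℝ) T, HasDerivAt J (J' t) t)
    (hineq : ∀ i : Fin d, ∀ t ∈ Set.Icc (0 : ℝ) T,
      J t i * J' t i ≥ -(c i) * |J t i|) :
    ∀ t ∈ Set.Icc (0 : ℝ) T,
      ‖J t‖ ≥ ‖J 0‖ - Real.sqrt (∑ i, (c i) ^ 2) * t := by
  intro t ht
  let u : EuclideanSpace ℝ (Fin d) := WithLp.toLp 2 fun i => |J t i|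
  let v : EuclideanSpace ℝ (Fin d) := WithLp.toLp 2 c
  have hu : ‖u‖ = ‖J t‖ := by simp [u, EuclideanSpace.norm_eq]
  have hv : ‖v‖ = √(∑ i, c i ^ 2) := by simp [v, EuclideanSpace.norm_eq]
  have hle : ‖J 0‖ ≤ ‖u + t • v‖ := by
    rw [EuclideanSpace.norm_eq, EuclideanSpace.norm_eq]
    refine Real.sqrt_le_sqrt (Finset.sum_le_sum fun i _ => ?_)
    have h : |J 0 i| - c i * t ≤ |J t i| := abs_sub_mul_le_abs_of_neg_mul_abs_le_mul_deriv (hc i)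
      (fun s hs => (EuclideanSpace.proj (𝕜 := ℝ) i).hasFDerivAt.comp_hasDerivAt s (hderiv s hs)) (hineq i) ht
    refine pow_le_pow_left₀ (norm_nonneg _) ?_ 2
    refine le_trans ?_ (le_abs_self _)
    simp only [u, v, PiLp.add_apply, PiLp.smul_apply, smul_eq_mul, Real.norm_eq_abs]
    linarith
  have htri := norm_add_le u (t • v)
  rw [norm_smul, Real.norm_of_nonneg ht.1, hu, hv] at htri
  linarith
end

section
/- Let d ≥ 1 and v ∈ ℝ^d with v ≠ 0. For i, k ∈ {1,…,d} define P_{ik} : ℝ^d \ {0} → ℝ by P_{ik}(w) = δ_{ik} − w_i w_k/‖w‖². Then for every i ∈ {1,…,d}: ∑_{j=1}^d ∑_{k=1}^d (∂P_{ik}/∂w_j)(v) · P_{jk}(v) = −(d−1)·v_i/‖v‖². -/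
/-- Directional derivative of the entries of the orthogonal projection onto `wᗮ`. -/
theorem fderiv_projection_entry {d : ℕ} (v e : EuclideanSpace ℝ (Fin d)) (hv : v ≠ 0)
    (c : ℝ) (i k : Fin d) :
    fderiv ℝ (fun w : EuclideanSpace ℝ (Fin d) => c - w i * w k / ‖w‖ ^ 2) v e
      = -((e i * v k + v i * e k) / ‖v‖ ^ 2)
        + 2 * v i * v k * inner ℝ v e / (‖v‖ ^ 2) ^ 2 := by
  have hN : ‖v‖ ^ 2 ≠ 0 := pow_ne_zero 2 (norm_ne_zero_iff.mpr hv)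
  have hcoord (l : Fin d) : HasFDerivAt (fun w : EuclideanSpace ℝ (Fin d) => w l)
      (EuclideanSpace.proj l : EuclideanSpace ℝ (Fin d) →L[ℝ] ℝ) v :=
    (EuclideanSpace.proj l : EuclideanSpace ℝ (Fin d) →L[ℝ] ℝ).hasFDerivAt
  have hnorm := (hasStrictFDerivAt_norm_sq v).hasFDerivAt
  have h := (((hcoord i).mul (hcoord k)).mul
    ((hasDerivAt_inv hN).comp_hasFDerivAt v hnorm)).const_sub c
  have h' : HasFDerivAt
      (fun w : EuclideanSpace ℝ (Fin d) => c - w i * w k / ‖w‖ ^ 2) _ v := h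
  rw [h'.fderiv]
  simp
  field_simp
  ring

/-- Itô correction of the orthogonal projection field: with
`P i k w = δ_{ik} - w i * w k / ‖w‖²`, for `v ≠ 0` one has
`∑ j, ∑ k, (∂ P i k / ∂ w j)(v) * P j k v = -(d-1) * v i / ‖v‖²`. -/
theorem ito_correction_projection
    (d : ℕ) (hd : 1 ≤ d) (v : EuclideanSpace ℝ (Fin d)) (hv : v ≠ 0) :
    ∀ i : Fin d,
      (∑ j : Fin d, ∑ k : Fin d,
        (fderiv ℝ (fun w : EuclideanSpace ℝ (Fin d) =>
            (if i = k then (1 : ℝ) else 0) - w i * w k / ‖w‖ ^ 2) v)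
          (EuclideanSpace.single j 1)
        * ((if j = k then (1 : ℝ) else 0) - v j * v k / ‖v‖ ^ 2))
      = -((d : ℝ) - 1) * v i / ‖v‖ ^ 2 := by
  intro i
  have hN : ‖v‖ ^ 2 ≠ 0 := pow_ne_zero 2 (norm_ne_zero_iff.mpr hv)
  have hsum : ∑ k, v k ^ 2 = ‖v‖ ^ 2 := (EuclideanSpace.real_norm_sq_eq v).symm
  simp_rw [fderiv_projection_entry v _ hv]
  generalize ‖v‖ ^ 2 = N at hN hsum ⊢
  have inner_sum (j : Fin d) : ∑ k : Fin d,
      (-(((EuclideanSpace.single j (1 : ℝ)) i * v k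
            + v i * (EuclideanSpace.single j (1 : ℝ)) k) / N)
        + 2 * v i * v k * inner ℝ v (EuclideanSpace.single j (1 : ℝ)) / N ^ 2)
        * ((if j = k then (1 : ℝ) else 0) - v j * v k / N)
      = -(v i / N) + v i / N ^ 2 * v j ^ 2 := by
    set a : ℝ := (EuclideanSpace.single j (1 : ℝ)) i
    have hterm (k : Fin d) :
        (-((a * v k + v i * (EuclideanSpace.single j (1 : ℝ)) k) / N)
          + 2 * v i * v k * inner ℝ v (EuclideanSpace.single j (1 : ℝ)) / N ^ 2)
          * ((if j = k then (1 : ℝ) else 0) - v j * v k / N)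
        = (if j = k then -(a * v j / N) - v i / N + 3 * v i * v j ^ 2 / N ^ 2 else 0)
          + (a * v j / N ^ 2 - 2 * v i * v j ^ 2 / N ^ 3) * v k ^ 2 := by
      by_cases hjk : j = k
      · subst hjk
        simp [EuclideanSpace.inner_single_right]
        field_simp
        ring
      · simp [EuclideanSpace.inner_single_right, hjk, Ne.symm hjk]
        field_simp
        ring
    simp_rw [hterm, Finset.sum_add_distrib, ← Finset.mul_sum, hsum]
    simp
    field_simp
    ring
  simp_rw [inner_sum, Finset.sum_add_distrib, ← Finset.mul_sum, hsum]
  simp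
  field_simp
  ring
end
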